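/- arXiv:1901.08031 — 2 statements merged into one kernel-verified Lean document; each statement's English description precedes it below -/
import Mathlib

section
/- Let N be a positive integer, 0 < s < 1 with N > 2s, and λ > 0. Let u ∈ L_{2s}, let x ∈ ℝ^N ∖ {0}, and suppose u is C^{1,1} in a neighbourhood of the point λ²x/|x|², and that u_λ ∈ L_{2s}. Then the principal value defining (-Δ)^s u_λ(x) exists and (-Δ)^s u_λ(x) = (λ/|x|)^{N+2s} (-Δ)^s u(λ²x/|x|²). -/
open MeasureTheory Filter Set

/-- The principal-value fractional Laplacian: `IsFracLapAt N s u x L` means that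
`lim_{ε→0⁺} ∫_{|y-x|>ε} (u(x)-u(y))/|x-y|^{N+2s} dy` exists and equals `L`. -/
def IsFracLapAt (N : ℕ) (s : ℝ) (u : EuclideanSpace ℝ (Fin N) → ℝ)
    (x : EuclideanSpace ℝ (Fin N)) (L : ℝ) : Prop :=
  Filter.Tendsto (fun ε : ℝ =>
      ∫ y in {y : EuclideanSpace ℝ (Fin N) | ε < ‖y - x‖},
        (u x - u y) / ‖x - y‖ ^ ((N : ℝ) + 2 * s))
    (nhdsWithin 0 (Set.Ioi 0)) (nhds L)

/-- The Kelvin transform `u_λ(x) = (λ/|x|)^{N-2s} u(λ²x/|x|²)`. -/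
noncomputable def kelvinTransform (N : ℕ) (s lam : ℝ)
    (u : EuclideanSpace ℝ (Fin N) → ℝ) (x : EuclideanSpace ℝ (Fin N)) : ℝ :=
  (lam / ‖x‖) ^ ((N : ℝ) - 2 * s) * u ((lam ^ 2 / ‖x‖ ^ 2) • x)

/-- `u` is `C^{1,1}` on a neighbourhood of `x`. -/
def C11Near (N : ℕ) (u : EuclideanSpace ℝ (Fin N) → ℝ)
    (x : EuclideanSpace ℝ (Fin N)) : Prop :=
  ∃ ε > 0, ContDiffOn ℝ 1 u (Metric.ball x ε) ∧
    ∃ K : NNReal, LipschitzOnWith K (fderiv ℝ u) (Metric.ball x ε)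

/-- The integrand of the fractional Laplacian, with exponent `p`. -/
noncomputable def fracKernel {N : ℕ} (p : ℝ) (u : EuclideanSpace ℝ (Fin N) → ℝ)
    (x z : EuclideanSpace ℝ (Fin N)) : ℝ :=
  (u x - u z) / ‖x - z‖ ^ p

theorem exists_one_add_norm_rpow_le {E : Type*} [NormedAddCommGroup E] {p ε : ℝ} (hp : 0 ≤ p)
    (hε : 0 < ε) (x : E) : ∃ C > 0, ∀ z : E, ε ≤ ‖x - z‖ → 1 + ‖z‖ ^ p ≤ C * ‖x - z‖ ^ p := by
  refine ⟨(1 / ε) ^ p + (1 + ‖x‖ / ε) ^ p, by positivity, fun z hz => ?_⟩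
  rw [add_mul, ← Real.mul_rpow (by positivity) (norm_nonneg _),
    ← Real.mul_rpow (by positivity) (norm_nonneg _)]
  have h1 : 1 ≤ 1 / ε * ‖x - z‖ := by
    rw [one_div, ← div_eq_inv_mul, one_le_div hε]
    exact hz
  refine add_le_add (Real.one_le_rpow h1 hp) (Real.rpow_le_rpow (norm_nonneg _) ?_ hp)
  have h2 : ‖z‖ ≤ ‖x‖ + ‖x - z‖ := by
    rw [norm_sub_rev]
    exact norm_le_norm_add_norm_sub' z x
  have h3 : ‖x‖ * 1 ≤ ‖x‖ * (1 / ε * ‖x - z‖) := by gcongr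
  calc ‖z‖ ≤ ‖x‖ * 1 + ‖x - z‖ := by simpa using h2
    _ ≤ ‖x‖ * (1 / ε * ‖x - z‖) + ‖x - z‖ := by gcongr
    _ = _ := by ring

theorem integrable_one_div_one_add_norm_rpow {N : ℕ} {p : ℝ} (hp : (N : ℝ) < p) :
    Integrable (fun z : EuclideanSpace ℝ (Fin N) => 1 / (1 + ‖z‖ ^ p)) := by
  have hp0 : 0 < p := lt_of_le_of_lt (Nat.cast_nonneg N) hp
  have h := integrable_one_add_norm (E := EuclideanSpace ℝ (Fin N)) (μ := volume) (r := p)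
    (by simpa using hp)
  refine (h.const_mul (2 ^ p)).mono' ?_ (Eventually.of_forall fun z => ?_)
  · exact (by fun_prop : Measurable fun z : EuclideanSpace ℝ (Fin N) =>
      1 / (1 + ‖z‖ ^ p)).aestronglyMeasurable
  · have hz : 0 ≤ ‖z‖ := norm_nonneg z
    rw [Real.norm_of_nonneg (by positivity), Real.rpow_neg (by positivity), ← div_eq_mul_inv,
      div_le_div_iff₀ (by positivity) (by positivity), one_mul]
    rcases le_total ‖z‖ 1 with h1 | h1
    · calc (1 + ‖z‖) ^ p ≤ 2 ^ p := Real.rpow_le_rpow (by positivity) (by linarith) hp0.le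
        _ ≤ _ := le_mul_of_one_le_right (by positivity) (by
          linarith [Real.rpow_nonneg hz p])
    · calc (1 + ‖z‖) ^ p ≤ (2 * ‖z‖) ^ p :=
            Real.rpow_le_rpow (by positivity) (by linarith) hp0.le
        _ = 2 ^ p * ‖z‖ ^ p := Real.mul_rpow (by positivity) hz
        _ ≤ _ := by gcongr; linarith

theorem integrableOn_fracKernel {N : ℕ} {p : ℝ} (hp : (N : ℝ) < p)
    {u : EuclideanSpace ℝ (Fin N) → ℝ} (hum : AEStronglyMeasurable u)
    (hu : Integrable (fun y : EuclideanSpace ℝ (Fin N) => |u y| / (1 + ‖y‖ ^ p)))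
    (x : EuclideanSpace ℝ (Fin N)) {ε : ℝ} (hε : 0 < ε) :
    IntegrableOn (fracKernel p u x) {z | ε ≤ ‖x - z‖} := by
  have hp0 : 0 < p := lt_of_le_of_lt (Nat.cast_nonneg N) hp
  obtain ⟨C, hC, hCz⟩ := exists_one_add_norm_rpow_le hp0.le hε x
  have hms : MeasurableSet {z : EuclideanSpace ℝ (Fin N) | ε ≤ ‖x - z‖} :=
    measurableSet_le measurable_const (by fun_prop)
  have hb := (((integrable_one_div_one_add_norm_rpow hp).const_mul |u x|).add hu).const_mul C
  refine Integrable.mono' hb.integrableOn ?_ ?_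
  · unfold fracKernel
    have h1 : AEStronglyMeasurable fun z : EuclideanSpace ℝ (Fin N) => (‖x - z‖ ^ p)⁻¹ :=
      (by fun_prop : Measurable fun z : EuclideanSpace ℝ (Fin N) =>
        (‖x - z‖ ^ p)⁻¹).aestronglyMeasurable
    simp only [div_eq_mul_inv]
    exact ((aestronglyMeasurable_const.sub hum).mul h1).restrict
  · filter_upwards [ae_restrict_mem hms] with z hz
    have hz0 : 0 < ‖x - z‖ := hε.trans_le hz
    simp only [Pi.add_apply]
    rw [fracKernel, norm_div, Real.norm_of_nonneg (Real.rpow_nonneg (norm_nonneg _) _),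
      Real.norm_eq_abs, mul_one_div, ← add_div, ← mul_div_assoc,
      div_le_div_iff₀ (by positivity) (by positivity)]
    calc |u x - u z| * (1 + ‖z‖ ^ p) ≤ (|u x| + |u z|) * (C * ‖x - z‖ ^ p) :=
          mul_le_mul (abs_sub _ _) (hCz z hz) (by positivity) (by positivity)
      _ = _ := by ring

theorem C11Near.exists_taylor_bound {N : ℕ} {u : EuclideanSpace ℝ (Fin N) → ℝ}
    {x : EuclideanSpace ℝ (Fin N)} (h : C11Near N u x) :
    ∃ r > 0, ∃ K : ℝ, 0 ≤ K ∧ ∃ φ : EuclideanSpace ℝ (Fin N) →L[ℝ] ℝ,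
      ∀ z, ‖x - z‖ < r → |u x - u z - φ (x - z)| ≤ K * ‖x - z‖ ^ 2 := by
  obtain ⟨r, hr, hd, K, hK⟩ := h
  refine ⟨r, hr, K, K.2, fderiv ℝ u x, fun z hz => ?_⟩
  have hsub : Metric.closedBall x ‖x - z‖ ⊆ Metric.ball x r := Metric.closedBall_subset_ball hz
  have hxr : x ∈ Metric.ball x r := Metric.mem_ball_self hr
  have hzb : z ∈ Metric.closedBall x ‖x - z‖ := by
    rw [Metric.mem_closedBall, dist_comm, dist_eq_norm]
  have := (convex_closedBall x ‖x - z‖).norm_image_sub_le_of_norm_fderiv_le' (𝕜 := ℝ) (f := u)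
    (φ := fderiv ℝ u x) (C := K * ‖x - z‖)
    (fun y hy => (hd.differentiableOn one_ne_zero).differentiableAt
      (Metric.isOpen_ball.mem_nhds (hsub hy)))
    (fun y hy => by
      have := hK.dist_le_mul y (hsub hy) x hxr
      rw [dist_eq_norm] at this
      refine this.trans ?_
      gcongr
      exact Metric.mem_closedBall.1 hy) hzb (Metric.mem_closedBall_self (norm_nonneg _))
  rw [Real.norm_eq_abs] at this
  exact this.trans_eq (by ring)

theorem integrableOn_ball_norm_sub_rpow {N : ℕ} (hN : 0 < N) {α : ℝ} (hα : α < N)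
    (x : EuclideanSpace ℝ (Fin N)) (r : ℝ) :
    IntegrableOn (fun z => ‖x - z‖ ^ (-α)) {z | ‖x - z‖ < r} := by
  have h := integrableOn_ball_of_norm_le_rpow (E := EuclideanSpace ℝ (Fin N)) (μ := volume)
    (f := fun z => ‖z‖ ^ (-α)) (C := 1) (α := α) (r := r) (by simpa using Nat.one_le_iff_ne_zero.2 hN.ne') (by simpa using hα)
    (Eventually.of_forall fun z => by
      rw [one_mul, Real.norm_of_nonneg (Real.rpow_nonneg (norm_nonneg _) _)])
    (by fun_prop : Measurable fun z : EuclideanSpace ℝ (Fin N) =>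
      ‖z‖ ^ (-α)).aestronglyMeasurable
  rw [← integrable_indicator_iff measurableSet_ball] at h
  have h2 := h.comp_sub_left x
  rw [← integrable_indicator_iff (measurableSet_lt (by fun_prop) measurable_const)]
  refine h2.congr (Eventually.of_forall fun z => ?_)
  by_cases hz : ‖x - z‖ < r
  · simp [indicator, hz]
  · simp [indicator, hz]

theorem exists_tendsto_integral_fracKernel {N : ℕ} (hN : 0 < N) {p : ℝ} (hp : (N : ℝ) < p)
    (hp2 : p < N + 2) {u : EuclideanSpace ℝ (Fin N) → ℝ} (hum : AEStronglyMeasurable u)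
    (hu : Integrable (fun y : EuclideanSpace ℝ (Fin N) => |u y| / (1 + ‖y‖ ^ p)))
    {x : EuclideanSpace ℝ (Fin N)} (hC : C11Near N u x) :
    ∃ L, Tendsto (fun ε : ℝ => ∫ z in {z | ε < ‖x - z‖}, fracKernel p u x z)
      (nhdsWithin 0 (Ioi 0)) (nhds L) := by
  have hp0 : 0 < p := lt_of_le_of_lt (Nat.cast_nonneg N) hp
  obtain ⟨r, hr, K, hK, φ, hφ⟩ := hC.exists_taylor_bound
  set B : Set (EuclideanSpace ℝ (Fin N)) := {w | ‖w‖ < r} with hB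
  set l : EuclideanSpace ℝ (Fin N) → ℝ := B.indicator fun w => φ w / ‖w‖ ^ p with hl
  set g : EuclideanSpace ℝ (Fin N) → ℝ := fun z => fracKernel p u x z - l (x - z) with hg
  have hBm : MeasurableSet B := measurableSet_lt (by fun_prop) measurable_const
  have hlm : Measurable l := by
    refine Measurable.indicator ?_ hBm
    fun_prop
  have hDm : AEStronglyMeasurable (fracKernel p u x) := by
    unfold fracKernel
    have h1 : AEStronglyMeasurable fun z : EuclideanSpace ℝ (Fin N) => (‖x - z‖ ^ p)⁻¹ :=
      (by fun_prop : Measurable fun z : EuclideanSpace ℝ (Fin N) =>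
        (‖x - z‖ ^ p)⁻¹).aestronglyMeasurable
    simp only [div_eq_mul_inv]
    exact (aestronglyMeasurable_const.sub hum).mul h1
  have hgm : AEStronglyMeasurable g :=
    hDm.sub (hlm.comp (measurable_const.sub measurable_id)).aestronglyMeasurable
  have hgi : Integrable g := by
    rw [← integrableOn_univ]
    have hun : (univ : Set (EuclideanSpace ℝ (Fin N))) =
        {z | ‖x - z‖ < r} ∪ {z | r ≤ ‖x - z‖} := by
      ext z
      simpa using lt_or_ge _ _
    rw [hun]
    refine IntegrableOn.union ?_ ?_
    · refine Integrable.mono'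
        ((integrableOn_ball_norm_sub_rpow hN (α := p - 2) (by linarith) x r).const_mul K)
        hgm.restrict ?_
      filter_upwards [ae_restrict_mem (measurableSet_lt (by fun_prop) measurable_const)] with z hz
      have hz' : ‖x - z‖ < r := hz
      have hgz : g z = (u x - u z - φ (x - z)) / ‖x - z‖ ^ p := by
        simp only [hg, hl, fracKernel, hB, indicator, mem_ofPred_eq, hz', if_true]
        ring
      rcases (norm_nonneg (x - z)).eq_or_lt with h0 | h0
      · rw [hgz, ← h0, Real.zero_rpow hp0.ne', div_zero, norm_zero]
        positivity
      · rw [hgz, norm_div, Real.norm_of_nonneg (Real.rpow_nonneg h0.le _),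
          div_le_iff₀ (by positivity), mul_assoc, ← Real.rpow_add h0, neg_sub,
          sub_add_cancel, Real.rpow_two]
        exact hφ z hz'
    · refine (integrableOn_fracKernel hp hum hu x hr).congr_fun ?_
        (measurableSet_le measurable_const (by fun_prop))
      intro z hz
      have hz' : ¬ ‖x - z‖ < r := not_lt.2 hz
      simp only [hg, hl, hB, indicator, mem_ofPred_eq, hz', if_false, sub_zero]
  have hTm : ∀ ε : ℝ, MeasurableSet {z : EuclideanSpace ℝ (Fin N) | ε < ‖x - z‖} := fun ε =>
    measurableSet_lt measurable_const (by fun_prop)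
  have hodd : ∀ ε : ℝ, ∫ z in {z | ε < ‖x - z‖}, l (x - z) = 0 := by
    intro ε
    set F : EuclideanSpace ℝ (Fin N) → ℝ := {w | ε < ‖w‖}.indicator l with hF
    have h1 : ∫ z in {z | ε < ‖x - z‖}, l (x - z) = ∫ z, F (x - z) := by
      rw [← integral_indicator (hTm ε)]
      rfl
    have h2 : ∀ w, F (-w) = -F w := by
      intro w
      simp only [hF, hl, hB, indicator, mem_ofPred_eq, norm_neg, map_neg]
      split_ifs <;> ring
    have h3 := integral_neg_eq_self F (volume : Measure (EuclideanSpace ℝ (Fin N)))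
    simp only [h2, integral_neg] at h3
    rw [h1, integral_sub_left_eq_self F volume x]
    linarith
  have heq : ∀ ε > 0, ∫ z in {z | ε < ‖x - z‖}, fracKernel p u x z =
      ∫ z, {z | ε < ‖x - z‖}.indicator g z := by
    intro ε hε
    have hDi : IntegrableOn (fracKernel p u x) {z | ε < ‖x - z‖} :=
      (integrableOn_fracKernel hp hum hu x hε).mono_set fun z (hz : ε < ‖x - z‖) => show ε ≤ ‖x - z‖ from hz.le
    have hli : IntegrableOn (fun z => l (x - z)) {z | ε < ‖x - z‖} :=
      (hDi.sub hgi.integrableOn).congr (Eventually.of_forall fun z => by simp [hg])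
    rw [integral_indicator (hTm ε), integral_sub hDi hli, hodd, sub_zero]
  refine ⟨∫ z, g z, Tendsto.congr' (f₁ := fun ε : ℝ =>
    ∫ z, {z | ε < ‖x - z‖}.indicator g z) ?_ ?_⟩
  · filter_upwards [self_mem_nhdsWithin] with ε hε using (heq ε hε).symm
  · refine tendsto_integral_filter_of_dominated_convergence (fun z => ‖g z‖)
      (Eventually.of_forall fun ε => hgm.indicator (hTm ε))
      (Eventually.of_forall fun ε => Eventually.of_forall fun z => norm_indicator_le_norm_self _ _)
      hgi.norm (Eventually.of_forall fun z => ?_)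
    rcases (norm_nonneg (x - z)).eq_or_lt with h0 | h0
    · have hg0 : g z = 0 := by
        simp only [hg, hl, fracKernel, indicator, ← h0, Real.zero_rpow hp0.ne', div_zero, ite_self,
          sub_zero]
      simp only [indicator, hg0, ite_self]
      exact tendsto_const_nhds
    · refine tendsto_const_nhds.congr' ?_
      filter_upwards [nhdsWithin_le_nhds (Iio_mem_nhds h0)] with ε hε
      rw [indicator_of_mem]
      exact hε

theorem tendsto_setIntegral_fracKernel_of_exists {N : ℕ} (hN : 0 < N) {p : ℝ} (hp : (N : ℝ) < p)
    (hp2 : p < N + 2) {u : EuclideanSpace ℝ (Fin N) → ℝ} (hum : AEStronglyMeasurable u)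
    (hu : Integrable (fun y : EuclideanSpace ℝ (Fin N) => |u y| / (1 + ‖y‖ ^ p)))
    {x : EuclideanSpace ℝ (Fin N)} (hx : x ≠ 0) (hC : C11Near N u x) {L : ℝ}
    (hL : Tendsto (fun ε : ℝ => ∫ z in {z | ε < ‖x - z‖}, fracKernel p u x z)
      (nhdsWithin 0 (Ioi 0)) (nhds L)) :
    Tendsto (fun δ : ℝ => ∫ z in {z | δ * ‖z‖ < ‖x - z‖}, fracKernel p u x z)
      (nhdsWithin 0 (Ioi 0)) (nhds L) := by
  have hp0 : 0 < p := lt_of_le_of_lt (Nat.cast_nonneg N) hp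
  have hx0 : 0 < ‖x‖ := norm_pos_iff.2 hx
  obtain ⟨r, hr, K, hK, φ, hφ⟩ := hC.exists_taylor_bound
  set M : ℝ := K * r + ‖φ‖ with hM
  have hM0 : 0 ≤ M := by positivity
  have hlip : ∀ z, ‖x - z‖ < r → |u x - u z| ≤ M * ‖x - z‖ := by
    intro z hz
    have h1 := hφ z hz
    have h2 : |φ (x - z)| ≤ ‖φ‖ * ‖x - z‖ := φ.le_opNorm _
    have h3 : K * ‖x - z‖ ^ 2 ≤ K * r * ‖x - z‖ := by
      rw [sq, ← mul_assoc]
      gcongr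
    have h4 := abs_add_le (u x - u z - φ (x - z)) (φ (x - z))
    rw [sub_add_cancel] at h4
    rw [hM, add_mul]
    linarith
  set c : ℝ := (volume : Measure (EuclideanSpace ℝ (Fin N))).real (Metric.ball 0 1) with hc
  have hbound : ∀ δ : ℝ, 0 < δ → δ ≤ 1 / 2 → δ < r / (2 * ‖x‖) →
      ‖(∫ z in {z | δ * ‖z‖ < ‖x - z‖}, fracKernel p u x z) -
        ∫ z in {z | δ * ‖x‖ < ‖x - z‖}, fracKernel p u x z‖ ≤
      (M * (2 * (δ * ‖x‖)) / (δ * ‖x‖ / 2) ^ p) *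
        ((δ * ‖x‖) ^ N * (3 * δ * N * 2 ^ (N - 1)) * c) := by
    intro δ hδ hδ2 hδr
    set ρ := δ * ‖x‖ with hρ
    have hρ0 : 0 < ρ := by positivity
    have hρr : 2 * ρ < r := by
      rw [lt_div_iff₀ (by positivity)] at hδr
      linarith
    set S := {z : EuclideanSpace ℝ (Fin N) | δ * ‖z‖ < ‖x - z‖} with hS
    set T := {z : EuclideanSpace ℝ (Fin N) | ρ < ‖x - z‖} with hT
    set A := Metric.closedBall x (ρ * (1 + 2 * δ)) \ Metric.ball x (ρ * (1 - δ)) with hA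
    have hSm : MeasurableSet S := measurableSet_lt (by fun_prop) (by fun_prop)
    have hTm : MeasurableSet T := measurableSet_lt (by fun_prop) (by fun_prop)
    have hAm : MeasurableSet A := measurableSet_closedBall.diff measurableSet_ball
    have hAfin : volume A < ⊤ :=
      (measure_mono sdiff_subset).trans_lt measure_closedBall_lt_top
    have hSi : IntegrableOn (fracKernel p u x) S := by
      refine (integrableOn_fracKernel hp hum hu x (ε := ρ / 2) (by positivity)).mono_set ?_
      intro z hz
      have hz' : δ * ‖z‖ < ‖x - z‖ := hz
      have h1 : ‖x‖ ≤ ‖z‖ + ‖x - z‖ := norm_le_norm_add_norm_sub' x z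
      have h2 : δ * ‖x‖ ≤ δ * (‖z‖ + ‖x - z‖) := by gcongr
      have h3 : δ * ‖x - z‖ ≤ 1 * ‖x - z‖ := by gcongr; linarith
      rw [mem_ofPred_eq, hρ]
      linarith
    have hTi : IntegrableOn (fracKernel p u x) T :=
      (integrableOn_fracKernel hp hum hu x hρ0).mono_set fun z (hz : ρ < ‖x - z‖) =>
        show ρ ≤ ‖x - z‖ from hz.le
    set Q : ℝ := M * (2 * ρ) / (ρ / 2) ^ p with hQ
    have hQ0 : 0 ≤ Q := by positivity
    have hAQ : ∀ z ∈ A, ‖fracKernel p u x z‖ ≤ Q := by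
      intro z hz
      have hz1 : ‖x - z‖ ≤ ρ * (1 + 2 * δ) := by
        simpa [dist_eq_norm, norm_sub_rev] using hz.1
      have hz2 : ρ * (1 - δ) ≤ ‖x - z‖ := by
        simpa [dist_eq_norm, norm_sub_rev] using hz.2
      have hz3 : ‖x - z‖ ≤ 2 * ρ := hz1.trans (by nlinarith)
      have hz4 : ρ / 2 ≤ ‖x - z‖ := le_trans (by nlinarith) hz2
      rw [fracKernel, norm_div, Real.norm_of_nonneg (Real.rpow_nonneg (norm_nonneg _) _)]
      refine div_le_div₀ (by positivity) ?_ (by positivity)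
        (Real.rpow_le_rpow (by positivity) hz4 hp0.le)
      exact (hlip z (hz3.trans_lt hρr)).trans (by gcongr)
    have hST : ∀ z, z ∉ A → (z ∈ S ↔ z ∈ T) := by
      intro z hzA
      have hzA' : ¬ (‖x - z‖ ≤ ρ * (1 + 2 * δ) ∧ ρ * (1 - δ) ≤ ‖x - z‖) := by
        simpa [hA, dist_eq_norm, norm_sub_rev] using hzA
      have h1 : ‖x‖ ≤ ‖z‖ + ‖x - z‖ := norm_le_norm_add_norm_sub' x z
      have h2 : ‖z‖ ≤ ‖x‖ + ‖x - z‖ := by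
        rw [norm_sub_rev]
        exact norm_le_norm_add_norm_sub' z x
      have h1' : δ * ‖x‖ ≤ δ * ‖z‖ + δ * ‖x - z‖ := by rw [← mul_add]; gcongr
      have h2' : δ * ‖z‖ ≤ δ * ‖x‖ + δ * ‖x - z‖ := by rw [← mul_add]; gcongr
      rw [← hρ] at h1' h2'
      rw [hS, hT, mem_ofPred_eq, mem_ofPred_eq]
      constructor
      · intro h
        by_contra! h3
        refine hzA' ⟨by nlinarith, ?_⟩
        have : δ * ‖x - z‖ ≤ δ * ρ := by gcongr
        linarith
      · intro h
        by_contra! h3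
        refine hzA' ⟨?_, by nlinarith⟩
        have h4 : (1 - δ) * ‖x - z‖ ≤ ρ := by linarith
        have h5 : ρ ≤ (1 - δ) * (ρ * (1 + 2 * δ)) := by
          have : 0 ≤ ρ * δ * (1 - 2 * δ) :=
            mul_nonneg (by positivity) (by linarith)
          linarith
        exact le_of_mul_le_mul_left (h4.trans h5) (by linarith)
    rw [← integral_indicator hSm, ← integral_indicator hTm, ← integral_sub
      (hSi.integrable_indicator hSm) (hTi.integrable_indicator hTm)]
    have : Nonempty (Fin N) := ⟨⟨0, hN⟩⟩
    have hvol : (volume : Measure (EuclideanSpace ℝ (Fin N))).real A ≤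
        ρ ^ N * (3 * δ * N * 2 ^ (N - 1)) * c := by
      have hsub : Metric.ball x (ρ * (1 - δ)) ⊆ Metric.closedBall x (ρ * (1 + 2 * δ)) :=
        Metric.ball_subset_closedBall.trans
          (Metric.closedBall_subset_closedBall (by nlinarith))
      rw [hA, measureReal_sdiff hsub measurableSet_ball measure_closedBall_lt_top.ne,
        ← Measure.addHaar_real_closedBall_eq_addHaar_real_ball,
        Measure.addHaar_real_closedBall _ _ (by positivity),
        Measure.addHaar_real_closedBall _ _ (mul_nonneg hρ0.le (by linarith)), finrank_euclideanSpace,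
        Fintype.card_fin, ← sub_mul, mul_pow ρ (1 + 2 * δ), mul_pow ρ (1 - δ), ← mul_sub]
      gcongr
      have h := abs_pow_sub_pow_le (1 + 2 * δ) (1 - δ) N
      refine (le_abs_self _).trans (h.trans ?_)
      have e1 : |1 + 2 * δ - (1 - δ)| = 3 * δ := by
        rw [abs_of_nonneg (by linarith)]
        ring
      have e2 : max |1 + 2 * δ| |1 - δ| ≤ 2 := by
        refine max_le ?_ ?_ <;> rw [abs_le] <;> constructor <;> linarith
      rw [e1]
      gcongr
    calc _ ≤ ∫ z, A.indicator (fun _ => Q) z := by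
          refine norm_integral_le_of_norm_le
            ((integrableOn_const hAfin.ne).integrable_indicator hAm)
            (Eventually.of_forall fun z => ?_)
          by_cases hzA : z ∈ A
          · have hz := hAQ z hzA
            rw [Real.norm_eq_abs] at hz
            rw [indicator_of_mem hzA]
            by_cases hzS : z ∈ S <;> by_cases hzT : z ∈ T <;>
              simp [indicator, hzS, hzT, hQ0, hz]
          · have := hST z hzA
            by_cases hzS : z ∈ S
            · simp [indicator, hzS, this.1 hzS, hzA]
            · simp [indicator, hzS, mt this.2 hzS, hzA]
      _ = Q * volume.real A := by
          rw [integral_indicator hAm, setIntegral_const, smul_eq_mul, mul_comm]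
      _ ≤ _ := by gcongr
  have hpow : Tendsto (fun δ : ℝ => (M * 2 * ‖x‖ / (‖x‖ / 2) ^ p *
      (‖x‖ ^ N * (3 * N * 2 ^ (N - 1)) * c)) * δ ^ ((N : ℝ) + 2 - p))
      (nhdsWithin 0 (Ioi 0)) (nhds 0) := by
    have h : Tendsto (fun δ : ℝ => δ ^ ((N : ℝ) + 2 - p)) (nhds 0) (nhds 0) := by
      have := (Real.continuousAt_rpow_const 0 ((N : ℝ) + 2 - p) (Or.inr (by linarith))).tendsto
      rwa [Real.zero_rpow (by linarith)] at this
    simpa using (h.mono_left nhdsWithin_le_nhds).const_mul _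
  have hdiff : Tendsto (fun δ : ℝ => (∫ z in {z | δ * ‖z‖ < ‖x - z‖}, fracKernel p u x z) -
        ∫ z in {z | δ * ‖x‖ < ‖x - z‖}, fracKernel p u x z) (nhdsWithin 0 (Ioi 0)) (nhds 0) := by
    refine squeeze_zero_norm' ?_ hpow
    filter_upwards [self_mem_nhdsWithin,
      nhdsWithin_le_nhds (Iic_mem_nhds (by norm_num : (0 : ℝ) < 1 / 2)),
      nhdsWithin_le_nhds (Iio_mem_nhds (by positivity : 0 < r / (2 * ‖x‖)))] with δ h1 h2 h3
    have hδ : 0 < δ := h1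
    refine (hbound δ h1 h2 h3).trans_eq ?_
    have e1 : (δ * ‖x‖ / 2) ^ p = δ ^ p * (‖x‖ / 2) ^ p := by
      rw [mul_div_assoc, Real.mul_rpow hδ.le (by positivity)]
    have e2 : δ ^ ((N : ℝ) + 2 - p) = δ ^ N * δ ^ 2 / δ ^ p := by
      rw [Real.rpow_sub hδ, Real.rpow_add hδ, Real.rpow_natCast, Real.rpow_two]
    have e3 : δ ^ p ≠ 0 := by positivity
    have e4 : (‖x‖ / 2) ^ p ≠ 0 := by positivity
    rw [e1, e2, mul_pow]
    field_simp
  have hscale : Tendsto (fun δ : ℝ => δ * ‖x‖) (nhdsWithin 0 (Ioi 0)) (nhdsWithin 0 (Ioi 0)) := by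
    refine tendsto_nhdsWithin_iff.2 ⟨?_, ?_⟩
    · have h : Tendsto (fun δ : ℝ => δ * ‖x‖) (nhds 0) (nhds (0 * ‖x‖)) :=
        (continuous_mul_const ‖x‖).tendsto 0
      rw [zero_mul] at h
      exact h.mono_left nhdsWithin_le_nhds
    · filter_upwards [self_mem_nhdsWithin] with δ hδ using mul_pos hδ hx0
  simpa using hdiff.add (hL.comp hscale)

theorem C11Near.of_contDiffAt {N : ℕ} {u : EuclideanSpace ℝ (Fin N) → ℝ}
    {x : EuclideanSpace ℝ (Fin N)} (h : ContDiffAt ℝ 2 u x) : C11Near N u x := by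
  obtain ⟨U, hU, hUd⟩ := (h.of_le (by norm_num) : ContDiffAt ℝ 1 u x).contDiffOn le_rfl (by simp)
  obtain ⟨K, V, hV, hVK⟩ := (h.fderiv_right (m := 1) (by norm_num)).exists_lipschitzOnWith
  obtain ⟨r, hr, hrs⟩ := Metric.mem_nhds_iff.1 (inter_mem hU hV)
  exact ⟨r, hr, hUd.mono (hrs.trans inter_subset_left), K, hVK.mono (hrs.trans inter_subset_right)⟩

theorem kelvinTransform_one {N : ℕ} {s c : ℝ} (z : EuclideanSpace ℝ (Fin N)) :
    kelvinTransform N s c (fun _ => 1) z = (c / ‖z‖) ^ ((N : ℝ) - 2 * s) := by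
  rw [kelvinTransform, mul_one]

theorem measurable_kelvinTransform_one (N : ℕ) (s c : ℝ) :
    Measurable (kelvinTransform N s c fun _ => 1) := by
  unfold kelvinTransform
  fun_prop

theorem C11Near.kelvinTransform_one {N : ℕ} {s c : ℝ} (hc : 0 < c)
    {x : EuclideanSpace ℝ (Fin N)} (hx : x ≠ 0) :
    C11Near N (kelvinTransform N s c fun _ => 1) x := by
  apply C11Near.of_contDiffAt
  have hx0 : 0 < ‖x‖ := norm_pos_iff.2 hx
  unfold kelvinTransform
  simp only [mul_one]
  exact (contDiffAt_const.div (contDiffAt_norm ℝ hx) hx0.ne').rpow_const_of_ne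
    (div_pos hc hx0).ne'

theorem integrable_kelvinTransform_one {N : ℕ} (hN : 0 < N) {s c p : ℝ} (hs : 0 < s)
    (hNs : 2 * s < (N : ℝ)) (hc : 0 < c) (hp : (N : ℝ) < p) :
    Integrable (fun y : EuclideanSpace ℝ (Fin N) =>
      |kelvinTransform N s c (fun _ => 1) y| / (1 + ‖y‖ ^ p)) := by
  have hm := measurable_kelvinTransform_one N s c
  have hm2 : AEStronglyMeasurable (fun y : EuclideanSpace ℝ (Fin N) =>
      |kelvinTransform N s c (fun _ => 1) y| / (1 + ‖y‖ ^ p)) :=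
    (by fun_prop : Measurable fun y : EuclideanSpace ℝ (Fin N) =>
      |kelvinTransform N s c (fun _ => 1) y| / (1 + ‖y‖ ^ p)).aestronglyMeasurable
  rw [← integrableOn_univ]
  have hun : (univ : Set (EuclideanSpace ℝ (Fin N))) =
      {z | ‖0 - z‖ < 1} ∪ {z | 1 ≤ ‖0 - z‖} := by
    ext z
    simpa using lt_or_ge _ _
  rw [hun]
  refine IntegrableOn.union ?_ ?_
  · refine Integrable.mono' ((integrableOn_ball_norm_sub_rpow hN (α := N - 2 * s) (by linarith)
      0 1).const_mul (c ^ ((N : ℝ) - 2 * s))) hm2.restrict (Eventually.of_forall fun z => ?_)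
    rw [zero_sub, norm_neg, kelvinTransform_one, Real.norm_of_nonneg (by positivity),
      abs_of_nonneg (by positivity), Real.div_rpow hc.le (norm_nonneg _),
      Real.rpow_neg (norm_nonneg _), ← div_eq_mul_inv]
    exact div_le_self (by positivity) (by
      linarith [Real.rpow_nonneg (norm_nonneg z) p])
  · refine Integrable.mono' ((integrable_one_div_one_add_norm_rpow hp).const_mul
      (c ^ ((N : ℝ) - 2 * s))).integrableOn hm2.restrict ?_
    filter_upwards [ae_restrict_mem (measurableSet_le measurable_const (by fun_prop))] with z hz
    have hz1 : 1 ≤ ‖z‖ := by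
      have hz' : 1 ≤ ‖0 - z‖ := hz
      simpa using hz'
    rw [kelvinTransform_one, Real.norm_of_nonneg (by positivity),
      abs_of_nonneg (by positivity), mul_one_div]
    refine div_le_div_of_nonneg_right (Real.rpow_le_rpow (by positivity) ?_ (by linarith))
      (by positivity)
    exact div_le_self hc.le hz1

theorem inversion_zero_eq_smul {N : ℕ} (lam : ℝ) (z : EuclideanSpace ℝ (Fin N)) :
    EuclideanGeometry.inversion 0 lam z = (lam ^ 2 / ‖z‖ ^ 2) • z := by
  simp [EuclideanGeometry.inversion, div_pow]

theorem norm_smul_inversion {N : ℕ} (lam : ℝ) (z : EuclideanSpace ℝ (Fin N)) :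
    ‖(lam ^ 2 / ‖z‖ ^ 2) • z‖ = lam ^ 2 / ‖z‖ := by
  rw [← inversion_zero_eq_smul, ← dist_zero_right, EuclideanGeometry.dist_inversion_center,
    dist_zero_right]

theorem norm_sub_inversion {N : ℕ} {lam : ℝ} (hlam : 0 < lam) {x z : EuclideanSpace ℝ (Fin N)}
    (hx : x ≠ 0) (hz : z ≠ 0) :
    ‖x - EuclideanGeometry.inversion 0 lam z‖ =
      ‖x‖ / ‖z‖ * ‖(lam ^ 2 / ‖x‖ ^ 2) • x - z‖ := by
  have hx0 : ‖x‖ ≠ 0 := norm_ne_zero_iff.2 hx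
  have hz0 : ‖z‖ ≠ 0 := norm_ne_zero_iff.2 hz
  have hx' : EuclideanGeometry.inversion 0 lam x ≠ 0 := by
    rwa [Ne, EuclideanGeometry.inversion_eq_center hlam.ne']
  conv_lhs => rw [← EuclideanGeometry.inversion_inversion 0 hlam.ne' x]
  rw [← dist_eq_norm, EuclideanGeometry.dist_inversion_inversion hx' hz,
    EuclideanGeometry.dist_inversion_center, inversion_zero_eq_smul, dist_zero_right,
    dist_zero_right, dist_eq_norm]
  field_simp

theorem fracKernel_kelvinTransform_inversion {N : ℕ} {s lam : ℝ} (hlam : 0 < lam)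
    (u : EuclideanSpace ℝ (Fin N) → ℝ) {x z : EuclideanSpace ℝ (Fin N)} (hx : x ≠ 0)
    (hz : z ≠ 0) :
    ((lam / ‖z‖) ^ 2) ^ N * fracKernel (N + 2 * s) (kelvinTransform N s lam u) x
        (EuclideanGeometry.inversion 0 lam z) =
      (lam / ‖x‖) ^ ((N : ℝ) + 2 * s) *
        (fracKernel (N + 2 * s) u ((lam ^ 2 / ‖x‖ ^ 2) • x) z - u ((lam ^ 2 / ‖x‖ ^ 2) • x) *
          fracKernel (N + 2 * s) (kelvinTransform N s (lam ^ 2 / ‖x‖) fun _ => 1)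
            ((lam ^ 2 / ‖x‖ ^ 2) • x) z) := by
  have hx0 : 0 < ‖x‖ := norm_pos_iff.2 hx
  have hz0 : 0 < ‖z‖ := norm_pos_iff.2 hz
  have hu : kelvinTransform N s lam u (EuclideanGeometry.inversion 0 lam z) =
      (‖z‖ / lam) ^ ((N : ℝ) - 2 * s) * u z := by
    rw [kelvinTransform, ← inversion_zero_eq_smul,
      EuclideanGeometry.inversion_inversion _ hlam.ne', inversion_zero_eq_smul,
      norm_smul_inversion]
    congr 2
    field_simp
  simp only [fracKernel]
  rw [hu, norm_sub_inversion hlam hx hz, kelvinTransform_one, kelvinTransform_one,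
    norm_smul_inversion, div_self (by positivity), Real.one_rpow, kelvinTransform]
  have hd0 := norm_nonneg ((lam ^ 2 / ‖x‖ ^ 2) • x - z)
  generalize ‖(lam ^ 2 / ‖x‖ ^ 2) • x - z‖ = d at hd0 ⊢
  generalize u ((lam ^ 2 / ‖x‖ ^ 2) • x) = v
  have e1 : ((lam / ‖z‖) ^ 2) ^ N =
      (lam / ‖z‖) ^ ((N : ℝ) + 2 * s) * (lam / ‖z‖) ^ ((N : ℝ) - 2 * s) := by
    rw [← pow_mul, ← Real.rpow_natCast, ← Real.rpow_add (by positivity)]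
    congr 1
    push_cast
    ring
  have e2 : (lam ^ 2 / ‖x‖ / ‖z‖) ^ ((N : ℝ) - 2 * s) =
      (lam / ‖x‖) ^ ((N : ℝ) - 2 * s) * (lam / ‖z‖) ^ ((N : ℝ) - 2 * s) := by
    rw [← Real.mul_rpow (by positivity) (by positivity)]
    congr 1
    field_simp
  have e3 : (‖z‖ / lam) ^ ((N : ℝ) - 2 * s) = ((lam / ‖z‖) ^ ((N : ℝ) - 2 * s))⁻¹ := by
    rw [← Real.inv_rpow (by positivity), inv_div]
  have e4 : (lam / ‖z‖) ^ ((N : ℝ) + 2 * s) =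
      (lam / ‖x‖) ^ ((N : ℝ) + 2 * s) * (‖x‖ / ‖z‖) ^ ((N : ℝ) + 2 * s) := by
    rw [← Real.mul_rpow (by positivity) (by positivity)]
    congr 1
    field_simp
  have h1 : (‖x‖ / ‖z‖) ^ ((N : ℝ) + 2 * s) ≠ 0 := by positivity
  have h2 : (lam / ‖z‖) ^ ((N : ℝ) - 2 * s) ≠ 0 := by positivity
  rw [e1, e2, e3, e4, Real.mul_rpow (by positivity) hd0]
  simp only [div_eq_mul_inv _ (d ^ ((N : ℝ) + 2 * s)),
    div_eq_mul_inv _ ((‖x‖ / ‖z‖) ^ ((N : ℝ) + 2 * s) * d ^ ((N : ℝ) + 2 * s)), mul_inv]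
  generalize (d ^ ((N : ℝ) + 2 * s))⁻¹ = D
  field_simp
  ring

theorem abs_det_fderiv_inversion {N : ℕ} (lam : ℝ) (z : EuclideanSpace ℝ (Fin N)) :
    |(((lam / dist z 0) ^ 2 • ((Submodule.span ℝ {z - 0})ᗮ.reflection :
      EuclideanSpace ℝ (Fin N) →L[ℝ] EuclideanSpace ℝ (Fin N)))).det| =
      ((lam / ‖z‖) ^ 2) ^ N := by
  rw [ContinuousLinearMap.det, ContinuousLinearMap.toLinearMap_smul, LinearMap.det_smul,
    finrank_euclideanSpace, Fintype.card_fin, abs_mul, dist_zero_right]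
  have h := (Submodule.span ℝ {z - 0})ᗮ.det_reflection
  have h2 : |LinearMap.det ((Submodule.span ℝ {z - 0})ᗮ.reflection :
      EuclideanSpace ℝ (Fin N) →L[ℝ] EuclideanSpace ℝ (Fin N)).toLinearMap| = 1 := by
    erw [h]
    rw [abs_pow, abs_neg, abs_one, one_pow]
  rw [h2, mul_one, abs_of_nonneg (by positivity)]

theorem integral_fracKernel_kelvinTransform {N : ℕ} (hN : 0 < N) {s lam : ℝ} (hlam : 0 < lam)
    (u : EuclideanSpace ℝ (Fin N) → ℝ) {x : EuclideanSpace ℝ (Fin N)} (hx : x ≠ 0) (ε : ℝ) :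
    ∫ y in {y | ε < ‖x - y‖}, fracKernel (N + 2 * s) (kelvinTransform N s lam u) x y =
      (lam / ‖x‖) ^ ((N : ℝ) + 2 * s) *
        ∫ z in {z | ε / ‖x‖ * ‖z‖ < ‖(lam ^ 2 / ‖x‖ ^ 2) • x - z‖},
          (fracKernel (N + 2 * s) u ((lam ^ 2 / ‖x‖ ^ 2) • x) z - u ((lam ^ 2 / ‖x‖ ^ 2) • x) *
            fracKernel (N + 2 * s) (kelvinTransform N s (lam ^ 2 / ‖x‖) fun _ => 1)
              ((lam ^ 2 / ‖x‖ ^ 2) • x) z) := by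
  have hx0 : 0 < ‖x‖ := norm_pos_iff.2 hx
  have : Nonempty (Fin N) := ⟨⟨0, hN⟩⟩
  set S : Set (EuclideanSpace ℝ (Fin N)) :=
    {z | ε / ‖x‖ * ‖z‖ < ‖(lam ^ 2 / ‖x‖ ^ 2) • x - z‖} with hS
  set T : Set (EuclideanSpace ℝ (Fin N)) := {y | ε < ‖x - y‖} with hT
  have hSm : MeasurableSet S := measurableSet_lt (by fun_prop) (by fun_prop)
  have hnull : ∀ A : Set (EuclideanSpace ℝ (Fin N)), (A \ {0} : Set _) =ᵐ[volume] A := fun A =>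
    sdiff_null_ae_eq_self (measure_singleton 0)
  have hiff : ∀ z, z ≠ 0 → (EuclideanGeometry.inversion 0 lam z ∈ T ↔ z ∈ S) := by
    intro z hz
    have hz0 : 0 < ‖z‖ := norm_pos_iff.2 hz
    rw [hS, hT, mem_ofPred_eq, mem_ofPred_eq, norm_sub_inversion hlam hx hz, div_mul_eq_mul_div,
      div_mul_eq_mul_div, lt_div_iff₀ hz0, div_lt_iff₀ hx0, mul_comm ‖x‖]
  have himage : EuclideanGeometry.inversion 0 lam '' (S \ {0}) = T \ {0} := by
    ext y
    constructor
    · rintro ⟨z, ⟨hzS, hz0⟩, rfl⟩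
      exact ⟨(hiff z hz0).2 hzS, (EuclideanGeometry.inversion_eq_center hlam.ne').not.2 hz0⟩
    · rintro ⟨hyT, hy0⟩
      have h0 : EuclideanGeometry.inversion 0 lam y ≠ 0 :=
        (EuclideanGeometry.inversion_eq_center hlam.ne').not.2 hy0
      refine ⟨EuclideanGeometry.inversion 0 lam y, ⟨?_, h0⟩,
        EuclideanGeometry.inversion_inversion 0 hlam.ne' y⟩
      rw [← hiff _ h0, EuclideanGeometry.inversion_inversion 0 hlam.ne' y]
      exact hyT
  rw [← setIntegral_congr_set (hnull T), ← setIntegral_congr_set (hnull S), ← himage,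
    integral_image_eq_integral_abs_det_fderiv_smul volume (hSm.diff (measurableSet_singleton 0))
      (fun z hz => (EuclideanGeometry.hasFDerivAt_inversion hz.2).hasFDerivWithinAt)
      (EuclideanGeometry.inversion_injective 0 hlam.ne').injOn, ← integral_const_mul]
  refine setIntegral_congr_fun (hSm.diff (measurableSet_singleton 0)) fun z hz => ?_
  simp only [smul_eq_mul]
  rw [abs_det_fderiv_inversion]
  exact fracKernel_kelvinTransform_inversion hlam u hx hz.2

theorem C11Near.aestronglyMeasurable_of_fracKernel {N : ℕ} {p : ℝ} (hp : 0 < p)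
    {u m : EuclideanSpace ℝ (Fin N) → ℝ} {x : EuclideanSpace ℝ (Fin N)} (hC : C11Near N u x)
    (hm : Measurable m) : ∃ r > 0, ∀ S : Set (EuclideanSpace ℝ (Fin N)),
      {z | r ≤ ‖x - z‖} ⊆ S →
        IntegrableOn (fun z => fracKernel p u x z - m z) S → AEStronglyMeasurable u := by
  obtain ⟨r, hr, hd, -⟩ := hC
  refine ⟨r, hr, fun S hS hi => ?_⟩
  have hun : Metric.ball x r ∪ S = univ := by
    refine eq_univ_of_forall fun z => ?_
    rcases lt_or_ge ‖x - z‖ r with h | h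
    · left
      rwa [Metric.mem_ball, dist_comm, dist_eq_norm]
    · exact Or.inr (hS h)
  rw [← Measure.restrict_univ (μ := volume), ← hun, aestronglyMeasurable_union_iff]
  refine ⟨hd.continuousOn.aestronglyMeasurable measurableSet_ball, ?_⟩
  have h1 : Measurable fun z : EuclideanSpace ℝ (Fin N) => ‖x - z‖ ^ p := by fun_prop
  refine (aestronglyMeasurable_const (b := u x)).sub
    ((hi.aestronglyMeasurable.add hm.aestronglyMeasurable).mul h1.aestronglyMeasurable) |>.congr
    (Eventually.of_forall fun z => ?_)
  simp only [Pi.sub_apply, Pi.add_apply, Pi.mul_apply, sub_add_cancel, fracKernel]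
  rcases eq_or_ne x z with rfl | h
  · simp [hp.ne']
  · have : 0 < ‖x - z‖ := norm_pos_iff.2 (sub_ne_zero.2 h)
    rw [div_mul_cancel₀ _ (by positivity)]
    ring

theorem eventually_subset_setOf_mul_norm_lt {E : Type*} [NormedAddCommGroup E] (x : E) {r : ℝ}
    (hr : 0 < r) :
    ∀ᶠ δ : ℝ in nhdsWithin 0 (Ioi 0), {z | r ≤ ‖x - z‖} ⊆ {z | δ * ‖z‖ < ‖x - z‖} := by
  filter_upwards [self_mem_nhdsWithin,
    nhdsWithin_le_nhds (Iio_mem_nhds (by positivity : 0 < r / (‖x‖ + r)))] with δ h1 h2 z hz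
  have hδ : 0 < δ := h1
  have hz' : r ≤ ‖x - z‖ := hz
  have h3 : δ * (‖x‖ + r) < r := (lt_div_iff₀ (by positivity)).1 h2
  have h4 : ‖z‖ ≤ ‖x‖ + ‖x - z‖ := by
    rw [norm_sub_rev]
    exact norm_le_norm_add_norm_sub' z x
  have h5 : δ * ‖z‖ ≤ δ * (‖x‖ + ‖x - z‖) := by gcongr
  have h6 : δ < 1 := by nlinarith [norm_nonneg x]
  show δ * ‖z‖ < ‖x - z‖
  nlinarith

theorem tendsto_div_nhdsGT_zero {c : ℝ} (hc : 0 < c) :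
    Tendsto (fun ε : ℝ => ε / c) (nhdsWithin 0 (Ioi 0)) (nhdsWithin 0 (Ioi 0)) := by
  refine tendsto_nhdsWithin_iff.2 ⟨?_, ?_⟩
  · have h : Tendsto (fun ε : ℝ => ε / c) (nhds 0) (nhds (0 / c)) := tendsto_id.div_const c
    rw [zero_div] at h
    exact h.mono_left nhdsWithin_le_nhds
  · filter_upwards [self_mem_nhdsWithin] with ε hε using div_pos hε hc

theorem isFracLapAt_iff {N : ℕ} {s : ℝ} {u : EuclideanSpace ℝ (Fin N) → ℝ}
    {x : EuclideanSpace ℝ (Fin N)} {L : ℝ} :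
    IsFracLapAt N s u x L ↔
      Tendsto (fun ε : ℝ => ∫ y in {y | ε < ‖x - y‖}, fracKernel (N + 2 * s) u x y)
        (nhdsWithin 0 (Ioi 0)) (nhds L) := by
  simp only [IsFracLapAt, fracKernel, norm_sub_rev x]

/-- The principal value at `x` of the Kelvin transform of `u`, in terms of the principal values of
`u` and of a multiple of the fundamental solution at the inverse point. -/
theorem tendsto_integral_fracKernel_kelvinTransform {N : ℕ} (hN : 0 < N) {s lam : ℝ} (hs0 : 0 < s)
    (hs1 : s < 1) (hNs : 2 * s < (N : ℝ)) (hlam : 0 < lam)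
    {u : EuclideanSpace ℝ (Fin N) → ℝ} (hum : AEStronglyMeasurable u)
    (hu : Integrable (fun y : EuclideanSpace ℝ (Fin N) => |u y| / (1 + ‖y‖ ^ ((N : ℝ) + 2 * s))))
    {x x' : EuclideanSpace ℝ (Fin N)} (hx : x ≠ 0) (hx' : x' = (lam ^ 2 / ‖x‖ ^ 2) • x)
    (hC : C11Near N u x') {L W : ℝ} (hL : IsFracLapAt N s u x' L)
    (hW : IsFracLapAt N s (kelvinTransform N s ‖x'‖ fun _ => 1) x' W) :
    IsFracLapAt N s (kelvinTransform N s lam u) x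
      ((lam / ‖x‖) ^ ((N : ℝ) + 2 * s) * (L - u x' * W)) := by
  have hx0 : 0 < ‖x‖ := norm_pos_iff.2 hx
  have hx'n : ‖x'‖ = lam ^ 2 / ‖x‖ := by rw [hx', norm_smul_inversion]
  have hx'0 : 0 < ‖x'‖ := by rw [hx'n]; positivity
  have hx'ne : x' ≠ 0 := norm_pos_iff.1 hx'0
  rw [isFracLapAt_iff] at hL hW ⊢
  have hp : (N : ℝ) < N + 2 * s := by linarith
  have hp2 : (N : ℝ) + 2 * s < N + 2 := by linarith
  have hwm := (measurable_kelvinTransform_one N s ‖x'‖).aestronglyMeasurable (μ := volume)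
  have hwi := integrable_kelvinTransform_one hN hs0 hNs hx'0 hp
  have hLS := tendsto_setIntegral_fracKernel_of_exists hN hp hp2 hum hu hx'ne hC hL
  have hWS := tendsto_setIntegral_fracKernel_of_exists hN hp hp2 hwm hwi hx'ne
    (C11Near.kelvinTransform_one hx'0 hx'ne) hW
  refine (((hLS.sub (hWS.const_mul (u x'))).const_mul ((lam / ‖x‖) ^ ((N : ℝ) + 2 * s))).comp
    (tendsto_div_nhdsGT_zero hx0)).congr' ?_
  filter_upwards [self_mem_nhdsWithin] with ε hε
  have hδ : 0 < ε / ‖x‖ := div_pos hε hx0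
  have hsub : {z | ε / ‖x‖ * ‖z‖ < ‖x' - z‖} ⊆
      {z | ε / ‖x‖ / (1 + ε / ‖x‖) * ‖x'‖ ≤ ‖x' - z‖} := by
    intro z hz
    have hz' : ε / ‖x‖ * ‖z‖ < ‖x' - z‖ := hz
    have h1 : ‖x'‖ ≤ ‖z‖ + ‖x' - z‖ := norm_le_norm_add_norm_sub' x' z
    show ε / ‖x‖ / (1 + ε / ‖x‖) * ‖x'‖ ≤ ‖x' - z‖
    rw [div_mul_eq_mul_div, div_le_iff₀ (by positivity)]
    nlinarith
  have hε' : 0 < ε / ‖x‖ / (1 + ε / ‖x‖) * ‖x'‖ := by positivity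
  have hui := (integrableOn_fracKernel hp hum hu x' hε').mono_set hsub
  have hwi' := (integrableOn_fracKernel hp hwm hwi x' hε').mono_set hsub
  rw [integral_fracKernel_kelvinTransform hN hlam u hx, ← hx', ← hx'n,
    integral_sub hui (hwi'.const_mul _), integral_const_mul]
  rfl

/-- The fundamental solution `|x|^{2s-N}` is `s`-harmonic away from the origin. -/
theorem isFracLapAt_kelvinTransform_one {N : ℕ} (hN : 0 < N) {s : ℝ} (hs0 : 0 < s)
    (hs1 : s < 1) (hNs : 2 * s < (N : ℝ)) {x : EuclideanSpace ℝ (Fin N)} (hx : x ≠ 0) :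
    IsFracLapAt N s (kelvinTransform N s ‖x‖ fun _ => 1) x 0 := by
  have hx0 : 0 < ‖x‖ := norm_pos_iff.2 hx
  have hp : (N : ℝ) < N + 2 * s := by linarith
  obtain ⟨W, hW⟩ := exists_tendsto_integral_fracKernel hN hp (by linarith)
    (measurable_kelvinTransform_one N s ‖x‖).aestronglyMeasurable
    (integrable_kelvinTransform_one hN hs0 hNs hx0 hp) (C11Near.kelvinTransform_one hx0 hx)
  rw [← isFracLapAt_iff] at hW
  have h1 : IsFracLapAt N s (fun _ => (1 : ℝ)) x 0 := by
    rw [isFracLapAt_iff]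
    simp [fracKernel]
  have h := tendsto_integral_fracKernel_kelvinTransform hN hs0 hs1 hNs hx0
    aestronglyMeasurable_const (by simpa using integrable_one_div_one_add_norm_rpow hp)
    hx (by rw [div_self (by positivity), one_smul])
    (C11Near.of_contDiffAt contDiffAt_const) h1 hW
  rw [div_self hx0.ne', Real.one_rpow] at h
  have hWW := tendsto_nhds_unique hW h
  have hW0 : W = 0 := by linarith
  rwa [hW0] at hW

/-- **Fractional Laplacian of the Kelvin transform** (equation (3.2)):
`(-Δ)^s u_λ(x) = (λ/|x|)^{N+2s} (-Δ)^s u(λ²x/|x|²)` for `x ≠ 0`. -/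
theorem fracLap_kelvinTransform
    (N : ℕ) (hN : 0 < N) (s lam : ℝ) (hs0 : 0 < s) (hs1 : s < 1)
    (hNs : 2 * s < (N : ℝ)) (hlam : 0 < lam)
    (u : EuclideanSpace ℝ (Fin N) → ℝ)
    (hu : Integrable (fun y : EuclideanSpace ℝ (Fin N) =>
      |u y| / (1 + ‖y‖ ^ ((N : ℝ) + 2 * s))))
    (x : EuclideanSpace ℝ (Fin N)) (hx : x ≠ 0)
    (hC11 : C11Near N u ((lam ^ 2 / ‖x‖ ^ 2) • x))
    (hukel : Integrable (fun y : EuclideanSpace ℝ (Fin N) =>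
      |kelvinTransform N s lam u y| / (1 + ‖y‖ ^ ((N : ℝ) + 2 * s)))) :
    ∃ L : ℝ, IsFracLapAt N s u ((lam ^ 2 / ‖x‖ ^ 2) • x) L ∧
      IsFracLapAt N s (kelvinTransform N s lam u) x
        ((lam / ‖x‖) ^ ((N : ℝ) + 2 * s) * L) := by
  have hx0 : 0 < ‖x‖ := norm_pos_iff.2 hx
  have hp : (N : ℝ) < N + 2 * s := by linarith
  set x' := (lam ^ 2 / ‖x‖ ^ 2) • x with hx'
  have hx'n : ‖x'‖ = lam ^ 2 / ‖x‖ := by rw [hx', norm_smul_inversion]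
  have hx'ne : x' ≠ 0 := norm_pos_iff.1 (by rw [hx'n]; positivity)
  by_cases hum : AEStronglyMeasurable u
  · obtain ⟨L, hL⟩ := exists_tendsto_integral_fracKernel hN hp (by linarith) hum hu hC11
    rw [← isFracLapAt_iff] at hL
    refine ⟨L, hL, ?_⟩
    simpa using tendsto_integral_fracKernel_kelvinTransform hN hs0 hs1 hNs hlam hum hu hx hx' hC11
      hL (isFracLapAt_kelvinTransform_one hN hs0 hs1 hNs hx'ne)
  -- If `u` is not measurable, both sides are eventually integrals of non-integrable functions.
  · refine ⟨0, ?_, ?_⟩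
    · obtain ⟨r, hr, hS⟩ := hC11.aestronglyMeasurable_of_fracKernel (p := N + 2 * s)
        (by positivity) (m := fun _ => 0) measurable_const
      rw [isFracLapAt_iff]
      refine tendsto_const_nhds.congr' ?_
      filter_upwards [nhdsWithin_le_nhds (Iio_mem_nhds hr)] with ε hε
      refine (integral_undef fun hi => hum (hS {z | ε < ‖x' - z‖} (fun z (hz : r ≤ ‖x' - z‖) =>
        show ε < ‖x' - z‖ from
        lt_of_lt_of_le hε hz) ?_)).symm
      simpa [IntegrableOn] using hi
    · have hm : Measurable fun z => u x' *
          fracKernel (N + 2 * s) (kelvinTransform N s ‖x'‖ fun _ => 1) x' z := by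
        have := measurable_kelvinTransform_one N s ‖x'‖
        unfold fracKernel
        fun_prop
      obtain ⟨r, hr, hS⟩ := hC11.aestronglyMeasurable_of_fracKernel (p := N + 2 * s)
        (by positivity) hm
      rw [isFracLapAt_iff, mul_zero]
      refine tendsto_const_nhds.congr' ?_
      filter_upwards [(tendsto_div_nhdsGT_zero hx0).eventually
        (eventually_subset_setOf_mul_norm_lt x' hr)] with ε hε
      rw [integral_fracKernel_kelvinTransform hN hlam u hx, ← hx', ← hx'n,
        integral_undef fun hi => hum (hS _ hε hi), mul_zero]
end

section
/- Let N be a positive integer and 0 < s < 1 with N > 2s. The function h(x) := |x|^{-(N-2s)}, defined on ℝ^N ∖ {0}, belongs to L_{2s}, and for every x ≠ 0 one has lim_{ε→0+} ∫_{|y-x|>ε} (h(x) - h(y))/|x-y|^{N+2s} dy = 0; that is, h is s-harmonic on ℝ^N ∖ {0}. -/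
open MeasureTheory Filter Set

section RieszKernel

open Module Metric EuclideanGeometry Topology

variable {E : Type*} [NormedAddCommGroup E] [InnerProductSpace ℝ E] [FiniteDimensional ℝ E]
  [MeasurableSpace E] [BorelSpace E]

theorem integrable_inv_one_add_norm_rpow {p : ℝ} (hp : (finrank ℝ E : ℝ) < p) :
    Integrable (fun y : E => (1 + ‖y‖ ^ p)⁻¹) := by
  have hp0 : 0 ≤ p := (Nat.cast_nonneg _).trans hp.le
  refine ((integrable_one_add_norm hp).const_mul ((2 : ℝ) ^ p)).mono'
    (Measurable.aestronglyMeasurable (by fun_prop)) (.of_forall fun y => ?_)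
  have h1 : (1 + ‖y‖) ^ p ≤ 2 ^ p * (1 + ‖y‖ ^ p) := by
    rcases le_total ‖y‖ 1 with h | h
    · calc (1 + ‖y‖) ^ p ≤ 2 ^ p := by gcongr; linarith
        _ ≤ 2 ^ p * (1 + ‖y‖ ^ p) := le_mul_of_one_le_right (by positivity)
          (le_add_of_nonneg_right (by positivity))
    · calc (1 + ‖y‖) ^ p ≤ (2 * ‖y‖) ^ p := by gcongr; linarith
        _ = 2 ^ p * ‖y‖ ^ p := Real.mul_rpow (by norm_num) (norm_nonneg y)
        _ ≤ 2 ^ p * (1 + ‖y‖ ^ p) := by gcongr; linarith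
  rw [Real.norm_of_nonneg (by positivity), Real.rpow_neg (by positivity), inv_eq_one_div,
    ← div_eq_mul_inv, div_le_div_iff₀ (by positivity) (by positivity)]
  linarith

theorem integrableOn_ball_norm_rpow_neg [Nontrivial E] {a : ℝ} (ha : a < finrank ℝ E) (r : ℝ) :
    IntegrableOn (fun y : E => ‖y‖ ^ (-a)) (ball 0 r) := by
  rw [integrableOn_fun_norm_addHaar volume (f := fun t : ℝ => t ^ (-a))]
  rcases le_or_gt r 0 with hr | hr
  · simp [Ioo_eq_empty (not_lt.2 hr)]
  have hd : 1 ≤ finrank ℝ E := finrank_pos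
  refine ((intervalIntegral.integrableOn_Ioo_rpow_iff (s := finrank ℝ E - 1 - a) hr).2
    (by linarith)).congr_fun (fun t ht => ?_) measurableSet_Ioo
  have h1 : ((finrank ℝ E - 1 : ℕ) : ℝ) = finrank ℝ E - 1 := by push_cast [hd]; ring
  simp only [smul_eq_mul]
  rw [← Real.rpow_natCast, ← Real.rpow_add ht.1, h1]
  ring_nf

theorem integrable_norm_rpow_neg_div_one_add_norm_rpow [Nontrivial E] {a p : ℝ} (ha0 : 0 ≤ a)
    (ha : a < finrank ℝ E) (hp : (finrank ℝ E : ℝ) < p) :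
    Integrable (fun y : E => ‖y‖ ^ (-a) / (1 + ‖y‖ ^ p)) := by
  refine ((integrableOn_ball_norm_rpow_neg (E := E) ha 1).integrable_indicator
    measurableSet_ball |>.add (integrable_inv_one_add_norm_rpow hp)).mono'
    (Measurable.aestronglyMeasurable (by fun_prop)) (.of_forall fun y => ?_)
  rw [Real.norm_of_nonneg (by positivity), Pi.add_apply]
  by_cases h : y ∈ ball (0 : E) 1
  · rw [indicator_of_mem h]
    have : ‖y‖ ^ (-a) / (1 + ‖y‖ ^ p) ≤ ‖y‖ ^ (-a) :=
      div_le_self (by positivity) (le_add_of_nonneg_right (by positivity))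
    have : 0 ≤ (1 + ‖y‖ ^ p)⁻¹ := by positivity
    linarith
  · rw [indicator_of_notMem h, zero_add, div_eq_mul_inv]
    refine mul_le_of_le_one_left (by positivity) (Real.rpow_le_one_of_one_le_of_nonpos ?_ ?_)
    · simpa using h
    · linarith

theorem inv_norm_sub_rpow_le {F : Type*} [SeminormedAddCommGroup F] {p η : ℝ} (hp : 0 ≤ p)
    (hη : 0 < η) {x y : F} (h : η < ‖y - x‖) :
    (‖x - y‖ ^ p)⁻¹ ≤ ((1 / η) ^ p + (‖x‖ / η + 1) ^ p) * (1 + ‖y‖ ^ p)⁻¹ := by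
  rw [norm_sub_rev] at h
  have h0 : 0 < ‖x - y‖ := hη.trans h
  have h1 : 1 ≤ 1 / η * ‖x - y‖ := by rw [one_div_mul_eq_div, one_le_div hη]; exact h.le
  have h2 : ‖y‖ ≤ (‖x‖ / η + 1) * ‖x - y‖ := by
    have h3 : ‖y‖ ≤ ‖x‖ + ‖x - y‖ := by simpa using norm_sub_le x (x - y)
    have h4 : ‖x‖ * 1 ≤ ‖x‖ * (1 / η * ‖x - y‖) := by gcongr
    calc ‖y‖ ≤ ‖x‖ * 1 + ‖x - y‖ := by linarith
      _ ≤ ‖x‖ * (1 / η * ‖x - y‖) + ‖x - y‖ := by gcongr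
      _ = _ := by ring
  rw [← div_eq_mul_inv, inv_eq_one_div, div_le_div_iff₀ (by positivity) (by positivity), add_mul,
    ← Real.mul_rpow (by positivity) h0.le, ← Real.mul_rpow (by positivity) h0.le, one_mul]
  gcongr
  exact Real.one_le_rpow h1 hp

theorem integrableOn_norm_rpow_sub_div [Nontrivial E] {a p η : ℝ} (ha0 : 0 ≤ a)
    (ha : a < finrank ℝ E) (hp : (finrank ℝ E : ℝ) < p) (hη : 0 < η) (x : E) :
    IntegrableOn (fun y : E => (‖x‖ ^ (-a) - ‖y‖ ^ (-a)) / ‖x - y‖ ^ p)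
      {y | η < ‖y - x‖} := by
  have hp0 : 0 ≤ p := (Nat.cast_nonneg _).trans hp.le
  refine Integrable.mono' (((integrable_inv_one_add_norm_rpow (E := E) hp).const_mul
    (‖x‖ ^ (-a)) |>.add (integrable_norm_rpow_neg_div_one_add_norm_rpow ha0 ha hp)).const_mul
      ((1 / η) ^ p + (‖x‖ / η + 1) ^ p)).integrableOn
    (Measurable.aestronglyMeasurable (by fun_prop))
    (ae_restrict_of_forall_mem (measurableSet_lt (by fun_prop) (by fun_prop)) fun y hy => ?_)
  have h1 : |‖x‖ ^ (-a) - ‖y‖ ^ (-a)| ≤ ‖x‖ ^ (-a) + ‖y‖ ^ (-a) :=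
    (abs_sub _ _).trans_eq (by
      rw [abs_of_nonneg (by positivity), abs_of_nonneg (by positivity)])
  rw [Real.norm_eq_abs, abs_div, abs_of_nonneg (by positivity : 0 ≤ ‖x - y‖ ^ p), div_eq_mul_inv,
    Pi.add_apply]
  calc _ ≤ (‖x‖ ^ (-a) + ‖y‖ ^ (-a)) *
        (((1 / η) ^ p + (‖x‖ / η + 1) ^ p) * (1 + ‖y‖ ^ p)⁻¹) :=
        mul_le_mul h1 (inv_norm_sub_rpow_le hp0 hη hy) (by positivity) (by positivity)
    _ = _ := by ring

theorem abs_det_smul_reflection {F : Type*} [NormedAddCommGroup F] [InnerProductSpace ℝ F]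
    [FiniteDimensional ℝ F] (c : ℝ) (K : Submodule ℝ F) :
    |(c • (K.reflection : F →L[ℝ] F)).det| = |c| ^ finrank ℝ F := by
  have h : (K.reflection : F →L[ℝ] F).det = (-1) ^ finrank ℝ Kᗮ := K.det_reflection
  rw [ContinuousLinearMap.det] at h ⊢
  rw [ContinuousLinearMap.toLinearMap_smul, LinearMap.det_smul, h, abs_mul, abs_pow, abs_pow,
    abs_neg, abs_one, one_pow, mul_one]

/-- The numerator of the kernel is odd under the inversion in the sphere of radius `‖x‖`. -/
theorem inversion_rpow_kernel_eq {d s r t q : ℝ} (hr : 0 < r) (ht : 0 < t) (hq : 0 ≤ q) :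
    ((r / t) ^ 2) ^ d * ((r ^ (-(d - 2 * s)) - (r ^ 2 / t) ^ (-(d - 2 * s))) /
      (r / t * q) ^ (d + 2 * s)) =
      -((r ^ (-(d - 2 * s)) - t ^ (-(d - 2 * s))) / q ^ (d + 2 * s)) := by
  have hrt : 0 < r / t := by positivity
  have h1 : r ^ 2 / t = r / t * r := by ring
  have h2 : ((r / t) ^ 2) ^ d = (r / t) ^ (d + 2 * s) * (r / t) ^ (d - 2 * s) := by
    rw [← Real.rpow_natCast, ← Real.rpow_mul hrt.le, ← Real.rpow_add hrt]
    push_cast; ring_nf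
  have h3 : (r / t) ^ (d - 2 * s) * r ^ (-(d - 2 * s)) = t ^ (-(d - 2 * s)) := by
    rw [Real.div_rpow hr.le ht.le, Real.rpow_neg hr.le, Real.rpow_neg ht.le]
    field_simp
  have h4 : (r / t) ^ (d - 2 * s) * (r / t * r) ^ (-(d - 2 * s)) = r ^ (-(d - 2 * s)) := by
    rw [Real.mul_rpow hrt.le hr.le, Real.rpow_neg hrt.le, ← mul_assoc,
      mul_inv_cancel₀ (by positivity), one_mul]
  rw [h1, h2, Real.mul_rpow hrt.le hq]
  have h5 : (r / t) ^ (d + 2 * s) ≠ 0 := by positivity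
  rw [mul_assoc, mul_div_assoc', mul_sub, h3, h4, mul_div_assoc', mul_div_mul_left _ _ h5,
    ← neg_div]
  exact congrArg (· / q ^ (d + 2 * s)) (neg_sub _ _).symm

theorem setIntegral_inversion_kernel [Nontrivial E] (s ε : ℝ) {x : E} (hx : x ≠ 0) :
    ∫ y in {y : E | ε < ‖y - x‖},
      (‖x‖ ^ (-((finrank ℝ E : ℝ) - 2 * s)) - ‖y‖ ^ (-((finrank ℝ E : ℝ) - 2 * s))) /
        ‖x - y‖ ^ ((finrank ℝ E : ℝ) + 2 * s) =
    -∫ y in {y : E | ε * ‖y‖ < ‖x‖ * ‖y - x‖},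
      (‖x‖ ^ (-((finrank ℝ E : ℝ) - 2 * s)) - ‖y‖ ^ (-((finrank ℝ E : ℝ) - 2 * s))) /
        ‖x - y‖ ^ ((finrank ℝ E : ℝ) + 2 * s) := by
  set r := ‖x‖ with hr_def
  have hr : 0 < r := norm_pos_iff.2 hx
  set f : E → ℝ := fun y =>
    (r ^ (-((finrank ℝ E : ℝ) - 2 * s)) - ‖y‖ ^ (-((finrank ℝ E : ℝ) - 2 * s))) /
        ‖x - y‖ ^ ((finrank ℝ E : ℝ) + 2 * s) with hf
  set A : Set E := {y | ε < ‖y - x‖}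
  set B : Set E := {y | ε * ‖y‖ < r * ‖y - x‖}
  have hB : MeasurableSet B := measurableSet_lt (by fun_prop) (by fun_prop)
  have hnorm : ∀ y : E, ‖inversion (0 : E) r y‖ = r ^ 2 / ‖y‖ := fun y => by
    simpa using dist_inversion_center (0 : E) y r
  have hdist : ∀ y : E, y ≠ 0 → ‖x - inversion (0 : E) r y‖ = r / ‖y‖ * ‖x - y‖ := fun y hy => by
    have h1 : inversion (0 : E) r x = x := inversion_of_mem_sphere (by simp [hr_def])
    have h2 := dist_inversion_inversion hx hy r
    rw [h1, dist_eq_norm, dist_zero_right, dist_zero_right, dist_eq_norm, ← hr_def] at h2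
    rw [h2]
    field_simp
  have hmem : ∀ y : E, y ≠ 0 → (inversion (0 : E) r y ∈ A ↔ y ∈ B) := fun y hy => by
    have hy' : 0 < ‖y‖ := norm_pos_iff.2 hy
    simp only [A, B, mem_ofPred_eq]
    rw [norm_sub_rev, hdist y hy, norm_sub_rev, div_mul_eq_mul_div, lt_div_iff₀ hy']
  have himage : inversion (0 : E) r '' (B \ {0}) = A \ {0} := by
    ext z
    constructor
    · rintro ⟨y, ⟨hyB, hy⟩, rfl⟩
      exact ⟨(hmem y hy).2 hyB, by simpa [hr.ne'] using hy⟩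
    · rintro ⟨hzA, hz⟩
      have hz' : inversion (0 : E) r z ≠ 0 := by simpa [hr.ne'] using hz
      refine ⟨inversion 0 r z, ⟨(hmem _ hz').1 ?_, hz'⟩, inversion_inversion _ hr.ne' z⟩
      rwa [inversion_inversion _ hr.ne']
  have hnull : ∀ S : Set E, ∫ y in S \ {0}, f y = ∫ y in S, f y := fun S =>
    setIntegral_congr_set (sdiff_null_ae_eq_self (measure_singleton 0))
  rw [← hnull A, ← hnull B, ← himage, integral_image_eq_integral_abs_det_fderiv_smul volume
    (hB.diff (measurableSet_singleton 0))
    (fun y hy => (hasFDerivAt_inversion (R := r) (c := (0 : E)) hy.2).hasFDerivWithinAt)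
    (inversion_injective _ hr.ne').injOn, ← integral_neg]
  refine setIntegral_congr_fun (hB.diff (measurableSet_singleton 0)) fun y hy => ?_
  have hy0 : y ≠ 0 := hy.2
  simp only [smul_eq_mul, hf]
  rw [abs_det_smul_reflection, hnorm, hdist y hy0, dist_zero_right, abs_of_nonneg (sq_nonneg _),
    ← Real.rpow_natCast]
  exact inversion_rpow_kernel_eq hr (norm_pos_iff.2 hy0) (norm_nonneg _)

/-- If `f` changes sign between integrals over `A` and `B`, the integral over `A` is controlled by
the values of `f` on any set containing the symmetric difference of `A` and `B`. -/
theorem norm_setIntegral_le_of_setIntegral_eq_neg {α : Type*} [MeasurableSpace α] {μ : Measure α}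
    {f : α → ℝ} {A B S : Set α} {C : ℝ} (hS : MeasurableSet S) (hSμ : μ S ≠ ⊤)
    (hA : IntegrableOn f A μ) (hB : IntegrableOn f B μ) (hAB : A \ S = B \ S)
    (hneg : ∫ y in A, f y ∂μ = -∫ y in B, f y ∂μ) (hC0 : 0 ≤ C) (hC : ∀ y ∈ S, |f y| ≤ C) :
    |∫ y in A, f y ∂μ| ≤ C * μ.real S := by
  have key : ∀ T : Set α, |∫ y in T ∩ S, f y ∂μ| ≤ C * μ.real S := fun T =>
    (norm_setIntegral_le_of_norm_le_const (f := f) ((measure_mono inter_subset_right).trans_lt hSμ.lt_top)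
      fun y hy => hC y hy.2).trans
      (mul_le_mul_of_nonneg_left (measureReal_mono inter_subset_right hSμ) hC0)
  have h1 := integral_inter_add_sdiff hS hA
  have h2 := integral_inter_add_sdiff hS hB
  rw [hAB] at h1
  have h3 := abs_le.1 (key A)
  have h4 := abs_le.1 (key B)
  exact abs_le.2 ⟨by linarith, by linarith⟩

theorem measureReal_closedBall_sdiff_closedBall (x : E) {a b : ℝ} (ha : 0 ≤ a)
    (hab : a ≤ b) :
    volume.real (closedBall x b \ closedBall x a) =
      (b ^ finrank ℝ E - a ^ finrank ℝ E) * volume.real (ball (0 : E) 1) := by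
  rw [measureReal_sdiff (closedBall_subset_closedBall hab) measurableSet_closedBall
    measure_closedBall_lt_top.ne,
    Measure.addHaar_real_closedBall _ _ (ha.trans hab), Measure.addHaar_real_closedBall _ _ ha,
    sub_mul]

theorem abs_setIntegral_kernel_le [Nontrivial E] {s ε K ρ : ℝ} (hs0 : 0 < s)
    (hs : 2 * s < finrank ℝ E) {x : E} (hx : x ≠ 0) (hε : 0 < ε) (hεx : ε ≤ ‖x‖ / 2)
    (hερ : 2 * ε < ρ) (hK : 0 ≤ K)
    (hlip : ∀ y, ‖y - x‖ < ρ → |‖y‖ ^ (-((finrank ℝ E : ℝ) - 2 * s)) -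
      ‖x‖ ^ (-((finrank ℝ E : ℝ) - 2 * s))| ≤ K * ‖y - x‖) :
    |∫ y in {y : E | ε < ‖y - x‖},
      (‖x‖ ^ (-((finrank ℝ E : ℝ) - 2 * s)) - ‖y‖ ^ (-((finrank ℝ E : ℝ) - 2 * s))) /
        ‖x - y‖ ^ ((finrank ℝ E : ℝ) + 2 * s)| ≤
    K * (2 * ε) / (ε / 2) ^ ((finrank ℝ E : ℝ) + 2 * s) *
      (((ε / (1 - ε / ‖x‖)) ^ finrank ℝ E - (ε * (1 - ε / ‖x‖)) ^ finrank ℝ E) *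
        volume.real (ball (0 : E) 1)) := by
  have hr : 0 < ‖x‖ := norm_pos_iff.2 hx
  obtain ⟨δ, hδ⟩ : ∃ δ, δ = ε / ‖x‖ := ⟨_, rfl⟩
  have hδε : δ * ‖x‖ = ε := by rw [hδ]; field_simp
  have hδ0 : 0 < δ := by rw [hδ]; positivity
  have hδ2 : δ ≤ 1 / 2 := by rw [hδ, div_le_iff₀ hr]; linarith
  rw [← hδ]
  have h1δ : 0 < 1 - δ := by linarith
  have hlow : ε / 2 ≤ ε * (1 - δ) := by nlinarith
  have hup : ε / (1 - δ) ≤ 2 * ε := by rw [div_le_iff₀ h1δ]; nlinarith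
  have hεup : ε ≤ ε / (1 - δ) := by rw [le_div_iff₀ h1δ]; nlinarith
  have hεlow : ε * (1 - δ) ≤ ε := by nlinarith
  rw [← measureReal_closedBall_sdiff_closedBall x (by positivity) (hεlow.trans hεup)]
  have hmem : ∀ y : E, y ∈ {y : E | ε * ‖y‖ < ‖x‖ * ‖y - x‖} ↔ δ * ‖y‖ < ‖y - x‖ := fun y => by
    rw [mem_ofPred_eq, ← hδε, mul_right_comm, mul_comm ‖x‖, mul_lt_mul_iff_left₀ hr]
  have htri : ∀ y : E, ‖y‖ ≤ ‖x‖ + ‖y - x‖ := fun y => by simpa using norm_add_le x (y - x)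
  have htri' : ∀ y : E, ‖x‖ ≤ ‖y‖ + ‖y - x‖ := fun y => by simpa using norm_sub_le y (y - x)
  have hBlow : ∀ y : E, δ * ‖y‖ < ‖y - x‖ → ε * (1 - δ) < ‖y - x‖ := fun y hy => by
    by_contra! hcon
    nlinarith [htri' y]
  have ha0 : 0 ≤ (finrank ℝ E : ℝ) - 2 * s := by linarith
  have hint := integrableOn_norm_rpow_sub_div (E := E) (p := (finrank ℝ E : ℝ) + 2 * s) ha0
    (by linarith) (by linarith) (by positivity : 0 < ε * (1 - δ)) x
  refine norm_setIntegral_le_of_setIntegral_eq_neg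
    (measurableSet_closedBall.diff measurableSet_closedBall)
    ((measure_mono sdiff_subset).trans_lt measure_closedBall_lt_top).ne
    (hint.mono_set fun y hy => hεlow.trans_lt hy)
    (hint.mono_set fun y hy => hBlow y ((hmem y).1 hy)) ?_
    (setIntegral_inversion_kernel s ε hx) (by positivity) ?_
  · ext y
    rw [Set.mem_sdiff (s := {y : E | ε < ‖y - x‖}),
      Set.mem_sdiff (s := {y : E | ε * ‖y‖ < ‖x‖ * ‖y - x‖}), hmem, mem_ofPred_eq]
    refine and_congr_left fun hy => ?_
    simp only [Set.mem_sdiff, mem_closedBall, dist_eq_norm, not_and, not_not] at hy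
    have hy' : ‖y - x‖ ≤ ε / (1 - δ) → ‖y - x‖ ≤ ε * (1 - δ) := hy
    rw [le_div_iff₀ h1δ] at hy'
    constructor
    · intro h
      by_contra! hcon
      have := hy' (by nlinarith [htri y])
      linarith
    · intro h
      have h2 := hBlow y h
      by_contra! hcon
      exact absurd (hy (hcon.trans hεup)) (not_le.2 h2)
  · rintro y ⟨hy1, hy2⟩
    rw [mem_closedBall, dist_eq_norm] at hy1 hy2
    rw [not_le] at hy2
    have h3 := hlip y (by linarith)
    rw [abs_div, abs_of_nonneg (Real.rpow_nonneg (norm_nonneg (x - y)) _), abs_sub_comm, norm_sub_rev x y]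
    gcongr
    · exact h3.trans (by gcongr; linarith)
    · linarith

theorem exists_norm_rpow_sub_le {F : Type*} [NormedAddCommGroup F] [InnerProductSpace ℝ F]
    (a : ℝ) {x : F} (hx : x ≠ 0) :
    ∃ K, 0 ≤ K ∧ ∃ ρ > 0, ∀ y : F, ‖y - x‖ < ρ →
      |‖y‖ ^ a - ‖x‖ ^ a| ≤ K * ‖y - x‖ := by
  have hd : DifferentiableAt ℝ (fun y : F => ‖y‖ ^ a) x :=
    (differentiableAt_id.norm ℝ hx).rpow_const (Or.inl (norm_ne_zero_iff.2 hx))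
  obtain ⟨K, hK, h⟩ := hd.isBigO_sub.exists_nonneg
  obtain ⟨ρ, hρ, h'⟩ := Metric.eventually_nhds_iff.1 h.bound
  exact ⟨K, hK, ρ, hρ, fun y hy => h' (by rwa [dist_eq_norm])⟩

theorem tendsto_shell_bound {s r : ℝ} (hs1 : s < 1) (K V : ℝ) (d : ℕ) :
    Tendsto (fun ε : ℝ => K * (2 * ε) / (ε / 2) ^ ((d : ℝ) + 2 * s) *
      (((ε / (1 - ε / r)) ^ d - (ε * (1 - ε / r)) ^ d) * V)) (𝓝[>] 0) (𝓝 0) := by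
  set g : ℝ → ℝ := fun ε => (1 - ε / r)⁻¹ ^ d - (1 - ε / r) ^ d with hg
  have hgd : DifferentiableAt ℝ g 0 := by
    have h1 : DifferentiableAt ℝ (fun ε : ℝ => 1 - ε / r) 0 := by fun_prop
    exact ((h1.inv (by simp)).pow d).sub (h1.pow d)
  have hslope : Tendsto (fun ε => ε⁻¹ * g ε) (𝓝[>] 0) (𝓝 (deriv g 0)) := by
    have h := hgd.hasDerivAt.tendsto_slope_zero_right
    simpa [hg] using h
  have hpow : Tendsto (fun ε : ℝ => ε ^ (2 - 2 * s)) (𝓝[>] 0) (𝓝 0) := by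
    have h := (Real.continuousAt_rpow_const 0 (2 - 2 * s) (Or.inr (by linarith))).tendsto
    rw [Real.zero_rpow (by linarith)] at h
    exact h.mono_left nhdsWithin_le_nhds
  have hlim := (hpow.mul hslope).const_mul (2 * K * V * 2 ^ ((d : ℝ) + 2 * s))
  rw [zero_mul, mul_zero] at hlim
  refine hlim.congr' ?_
  filter_upwards [self_mem_nhdsWithin] with ε (hε : 0 < ε)
  have h1 : ε ^ (2 - 2 * s) * ε ^ ((d : ℝ) + 2 * s) = ε ^ d * ε * ε := by
    rw [← Real.rpow_add hε, ← Real.rpow_natCast, mul_assoc, ← sq, ← Real.rpow_natCast ε 2,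
      ← Real.rpow_add hε]
    push_cast; ring_nf
  have h2 : (ε / (1 - ε / r)) ^ d - (ε * (1 - ε / r)) ^ d = ε ^ d * g ε := by
    rw [hg, div_eq_mul_inv, mul_pow, mul_pow, mul_sub]
  have h3 : ε ^ ((d : ℝ) + 2 * s) ≠ 0 := by positivity
  have h4 : ε ^ (2 - 2 * s) = ε ^ d * ε * ε / ε ^ ((d : ℝ) + 2 * s) := by
    rw [← h1, mul_div_cancel_right₀ _ h3]
  rw [h2, h4, Real.div_rpow hε.le (by norm_num)]
  field_simp

theorem tendsto_setIntegral_kernel [Nontrivial E] {s : ℝ} (hs0 : 0 < s) (hs1 : s < 1)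
    (hs : 2 * s < finrank ℝ E) {x : E} (hx : x ≠ 0) :
    Tendsto (fun ε : ℝ => ∫ y in {y : E | ε < ‖y - x‖},
      (‖x‖ ^ (-((finrank ℝ E : ℝ) - 2 * s)) - ‖y‖ ^ (-((finrank ℝ E : ℝ) - 2 * s))) /
        ‖x - y‖ ^ ((finrank ℝ E : ℝ) + 2 * s)) (𝓝[>] 0) (𝓝 0) := by
  obtain ⟨K, hK, ρ, hρ, hlip⟩ := exists_norm_rpow_sub_le (-((finrank ℝ E : ℝ) - 2 * s)) hx
  have hr : 0 < ‖x‖ := norm_pos_iff.2 hx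
  refine squeeze_zero_norm' ?_
    (tendsto_shell_bound (r := ‖x‖) hs1 K (volume.real (ball (0 : E) 1)) (finrank ℝ E))
  filter_upwards [Ioo_mem_nhdsGT (lt_min (half_pos hr) (half_pos hρ))] with ε hε
  have h1 := lt_min_iff.1 hε.2
  exact abs_setIntegral_kernel_le hs0 hs hx hε.1 h1.1.le (by linarith [h1.2]) hK hlip

end RieszKernel

/-- **`|x|^{2s-N}` is `s`-harmonic away from the origin**: the function
`h(x) = |x|^{-(N-2s)}` belongs to `L_{2s}` and its principal-value fractional Laplacian
vanishes at every `x ≠ 0`. -/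
theorem fundamental_solution_sHarmonic
    (N : ℕ) (hN : 0 < N) (s : ℝ) (hs0 : 0 < s) (hs1 : s < 1)
    (hNs : 2 * s < (N : ℝ)) :
    Integrable (fun y : EuclideanSpace ℝ (Fin N) =>
      |‖y‖ ^ (-((N : ℝ) - 2 * s))| / (1 + ‖y‖ ^ ((N : ℝ) + 2 * s))) ∧
    ∀ x : EuclideanSpace ℝ (Fin N), x ≠ 0 →
      Filter.Tendsto (fun ε : ℝ =>
          ∫ y in {y : EuclideanSpace ℝ (Fin N) | ε < ‖y - x‖},
            (‖x‖ ^ (-((N : ℝ) - 2 * s)) - ‖y‖ ^ (-((N : ℝ) - 2 * s)))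
              / ‖x - y‖ ^ ((N : ℝ) + 2 * s))
        (nhdsWithin 0 (Set.Ioi 0)) (nhds 0) := by
  have : Nontrivial (EuclideanSpace ℝ (Fin N)) := by
    have : Nonempty (Fin N) := ⟨⟨0, hN⟩⟩
    infer_instance
  have hd : Module.finrank ℝ (EuclideanSpace ℝ (Fin N)) = N := finrank_euclideanSpace_fin
  constructor
  · simp_rw [abs_of_nonneg (Real.rpow_nonneg (norm_nonneg _) _)]
    exact integrable_norm_rpow_neg_div_one_add_norm_rpow (by linarith) (by rw [hd]; linarith)
      (by rw [hd]; linarith)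
  · intro x hx
    have h := tendsto_setIntegral_kernel hs0 hs1 (by rwa [hd]) hx
    rwa [hd] at h
end
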